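/- Under the standing assumptions on a and q, for every bounded set K ⊂ [0,∞) there exist constants C > 0 and b₀ > 0 such that for all c ∈ K, all real b ≥ b₀, and every real M with M < N_A(c), there exists a nonzero Schwartz function u : ℝ → ℂ with M·‖T(λ)u‖ ≤ (2b + C)·‖u‖, where λ = −c + i·b. (This expresses the lower bound ‖T(λ)^{-1}‖ ≥ N_A(c)·(2b)^{-1}·(1 − O_K(b^{-1})), showing the local estimate near the turning points cannot be improved.) -/

import Mathlib

open MeasureTheory Filter
open scoped ENNReal

/-- The quadratic operator family `T(λ)u = -u'' + q·u + 2λ·a·u + λ²·u`. -/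
noncomputable def Tq (a q : ℝ → ℝ) (lam : ℂ) (u : ℝ → ℂ) : ℝ → ℂ :=
  fun x => -deriv (deriv u) x + (q x : ℂ) * u x + 2 * lam * (a x : ℂ) * u x + lam ^ 2 * u x

/-- Standing assumptions on the damping `a` and the potential `q`. -/
structure Standing (a q : ℝ → ℝ) : Prop where
  smooth_a : ContDiff ℝ (⊤ : ℕ∞) a
  smooth_q : ContDiff ℝ (⊤ : ℕ∞) q
  nonneg_a : ∀ x, 0 ≤ a x
  nonneg_q : ∀ x, 0 ≤ q x
  unbounded_a : Tendsto a (cocompact ℝ) atTop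
  deriv_a : ∀ n : ℕ, 1 ≤ n → ∃ C : ℝ, 0 < C ∧ ∀ x : ℝ,
      |iteratedDeriv n a x| ≤ C * (1 + a x) * (1 + x ^ 2) ^ (-(n : ℝ) / 2)
  deriv_q : ∀ n : ℕ, 1 ≤ n → ∃ C : ℝ, 0 < C ∧ ∀ x : ℝ,
      |iteratedDeriv n q x| ≤ C * (1 + q x) * (1 + x ^ 2) ^ (-(n : ℝ) / 2)
  q_le_a : ∃ K₀ : ℝ, 0 < K₀ ∧ ∃ x₀ : ℝ, 0 < x₀ ∧ ∀ x : ℝ, x₀ < |x| → q x ≤ K₀ * a x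

/-- The norm of the resolvent `(A - c)⁻¹` of the generalised Airy operator
`A = -d/dx + a`, as the supremum of `‖u‖ / ‖-u' + a·u - c·u‖` over nonzero
Schwartz functions, valued in `[0,∞]`. -/
noncomputable def NA (a : ℝ → ℝ) (c : ℝ) : ℝ≥0∞ :=
  ⨆ (u : SchwartzMap ℝ ℂ) (_ : u ≠ 0),
    eLpNorm (⇑u) 2 volume /
      eLpNorm (fun x => -deriv (⇑u) x + (a x : ℂ) * u x - (c : ℂ) * u x) 2 volume

open scoped SchwartzMap ContDiff

/-- Polynomial growth from the logarithmic-derivative bound (half line). -/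
lemma growth_half (f : ℝ → ℝ) (hf : Differentiable ℝ f) (hnn : ∀ x, 0 ≤ f x) (k : ℕ)
    (hd : ∀ x, |deriv f x| ≤ (k : ℝ) * (1 + f x) * (√(1 + x ^ 2))⁻¹) (x : ℝ) (hx : 0 ≤ x) :
    1 + f x ≤ (1 + f 0) * (1 + 2 * x) ^ k := by
  have hder : ∀ y, HasDerivAt (fun y => (1 + f y) * Real.exp (-(k * Real.arsinh y)))
      (deriv f y * Real.exp (-(k * Real.arsinh y)) +
        (1 + f y) * (Real.exp (-(k * Real.arsinh y)) * (-(k * (√(1 + y ^ 2))⁻¹)))) y := by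
    intro y
    have h1 : HasDerivAt (fun y => 1 + f y) (deriv f y) y := (hf y).hasDerivAt.const_add 1
    exact h1.mul (((Real.hasDerivAt_arsinh y).const_mul (k : ℝ)).neg.exp)
  have hanti : Antitone (fun y => (1 + f y) * Real.exp (-(k * Real.arsinh y))) := by
    apply antitone_of_deriv_nonpos
    · exact fun y => (hder y).differentiableAt
    · intro y
      rw [(hder y).deriv]
      have h1 := (abs_le.1 (hd y)).2
      have h2 := Real.exp_pos (-(k * Real.arsinh y))
      nlinarith
  have h := hanti hx
  simp only [Real.arsinh_zero, mul_zero, neg_zero, Real.exp_zero, mul_one] at h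
  have e1 : Real.exp (k * Real.arsinh x) ≤ (1 + 2 * x) ^ k := by
    rw [Real.exp_nat_mul, Real.exp_arsinh]
    have : √(1 + x ^ 2) ≤ 1 + x := by
      rw [Real.sqrt_le_left (by linarith)]; nlinarith
    have h0 := Real.sqrt_nonneg (1 + x ^ 2)
    exact pow_le_pow_left₀ (by linarith) (by linarith) k
  have e2 : (1 + f x) = ((1 + f x) * Real.exp (-(k * Real.arsinh x))) *
      Real.exp (k * Real.arsinh x) := by
    rw [mul_assoc, ← Real.exp_add]; simp
  rw [e2]
  have := hnn 0
  have := hnn x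
  gcongr

lemma growth_full (f : ℝ → ℝ) (hf : Differentiable ℝ f) (hnn : ∀ x, 0 ≤ f x) (C : ℝ)
    (hd : ∀ x, |deriv f x| ≤ C * (1 + f x) * (√(1 + x ^ 2))⁻¹) :
    ∃ (k : ℕ) (D : ℝ), 0 < D ∧ ∀ x, 1 + f x ≤ D * (1 + ‖x‖) ^ k := by
  obtain ⟨k, hk⟩ := exists_nat_ge C
  have hd' : ∀ x, |deriv f x| ≤ (k : ℝ) * (1 + f x) * (√(1 + x ^ 2))⁻¹ := by
    intro x
    refine (hd x).trans ?_
    have := hnn x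
    gcongr
  refine ⟨k, (1 + f 0) * 2 ^ k, by have := hnn 0; positivity, fun x => ?_⟩
  have key : 1 + f x ≤ (1 + f 0) * (1 + 2 * |x|) ^ k := by
    rcases le_total 0 x with hx | hx
    · rw [abs_of_nonneg hx]; exact growth_half f hf hnn k hd' x hx
    · rw [abs_of_nonpos hx]
      have := growth_half (fun y => f (-y)) (hf.comp differentiable_neg) (fun y => hnn _) k
        (fun y => by
          rw [deriv_comp_neg, abs_neg]
          simpa using hd' (-y)) (-x) (by linarith)
      simpa using this
  refine key.trans ?_
  rw [mul_assoc, ← mul_pow, Real.norm_eq_abs]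
  have := hnn 0
  gcongr
  linarith

lemma symbol_temperate (f : ℝ → ℝ) (hs : ContDiff ℝ (⊤ : ℕ∞) f) (hnn : ∀ x, 0 ≤ f x)
    (hd : ∀ n : ℕ, 1 ≤ n → ∃ C : ℝ, 0 < C ∧ ∀ x : ℝ,
      |iteratedDeriv n f x| ≤ C * (1 + f x) * (1 + x ^ 2) ^ (-(n : ℝ) / 2)) :
    f.HasTemperateGrowth := by
  obtain ⟨C1, hC1, h1⟩ := hd 1 le_rfl
  obtain ⟨k, D, hD, hg⟩ := growth_full f (hs.differentiable (by simp)) hnn C1 (by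
    intro x
    have := h1 x
    rw [iteratedDeriv_one] at this
    convert this using 2
    rw [Real.sqrt_eq_rpow, ← Real.rpow_neg (by positivity)]
    norm_num)
  refine ⟨hs, fun n => ?_⟩
  rcases Nat.eq_zero_or_pos n with rfl | hn
  · refine ⟨k, D, fun x => ?_⟩
    simp only [norm_iteratedFDeriv_zero]
    rw [Real.norm_of_nonneg (hnn x)]
    linarith [hg x]
  · obtain ⟨C, hC, h⟩ := hd n hn
    refine ⟨k, C * D, fun x => ?_⟩
    rw [norm_iteratedFDeriv_eq_norm_iteratedDeriv, Real.norm_eq_abs]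
    refine (h x).trans ?_
    have e : (1 + x ^ 2) ^ (-(n : ℝ) / 2) ≤ 1 :=
      Real.rpow_le_one_of_one_le_of_nonpos (by nlinarith [sq_nonneg x])
        (by have : (0 : ℝ) ≤ n := by positivity
            linarith)
    have := hnn x
    calc C * (1 + f x) * (1 + x ^ 2) ^ (-(n : ℝ) / 2) ≤ C * (1 + f x) * 1 := by gcongr
      _ ≤ C * (D * (1 + ‖x‖) ^ k) := by rw [mul_one]; gcongr; exact hg x
      _ = _ := by ring

lemma symbol_deriv_bound (f : ℝ → ℝ) (hnn : ∀ x, 0 ≤ f x)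
    (hd : ∀ n : ℕ, 1 ≤ n → ∃ C : ℝ, 0 < C ∧ ∀ x : ℝ,
      |iteratedDeriv n f x| ≤ C * (1 + f x) * (1 + x ^ 2) ^ (-(n : ℝ) / 2)) :
    ∃ C : ℝ, 0 < C ∧ ∀ x, |deriv f x| ≤ C * (1 + f x) := by
  obtain ⟨C, hC, h⟩ := hd 1 le_rfl
  refine ⟨C, hC, fun x => ?_⟩
  have h := h x
  rw [iteratedDeriv_one] at h
  refine h.trans ?_
  have e : (1 + x ^ 2) ^ (-((1 : ℕ) : ℝ) / 2) ≤ 1 :=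
    Real.rpow_le_one_of_one_le_of_nonpos (by nlinarith [sq_nonneg x]) (by norm_num)
  have := hnn x
  calc _ ≤ C * (1 + f x) * 1 := by gcongr
    _ = _ := by ring

lemma temperate_deriv (f : ℝ → ℝ) (hf : f.HasTemperateGrowth) :
    (deriv f).HasTemperateGrowth := by
  refine ⟨?_, fun n => ?_⟩
  · exact ContDiff.deriv' (n := ∞) hf.1
  · obtain ⟨k, C, h⟩ := hf.2 (n + 1)
    refine ⟨k, C, fun x => ?_⟩
    have := h x
    rwa [norm_iteratedFDeriv_eq_norm_iteratedDeriv, iteratedDeriv_succ'] at *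

lemma temperate_exp (b : ℝ) :
    (fun x : ℝ => Complex.exp (Complex.I * b * x)).HasTemperateGrowth := by
  have hd : ∀ x : ℝ, HasDerivAt (fun x : ℝ => Complex.exp (Complex.I * b * x))
      ((Complex.I * b) * Complex.exp (Complex.I * b * x)) x := by
    intro x
    have := ((Complex.ofRealCLM.hasDerivAt (x := x)).const_mul (Complex.I * b)).cexp
    simp only [Complex.ofRealCLM_apply, Complex.ofReal_one, mul_one] at this
    rwa [mul_comm (Complex.I * (b : ℂ)) (Complex.exp _)]
  have hi : ∀ n : ℕ, iteratedDeriv n (fun x : ℝ => Complex.exp (Complex.I * b * x)) =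
      fun x : ℝ => (Complex.I * b) ^ n * Complex.exp (Complex.I * b * x) := by
    intro n
    induction n with
    | zero => simp
    | succ n ih =>
      rw [iteratedDeriv_succ, ih]
      ext x
      rw [((hd x).const_mul _).deriv]; ring
  refine ⟨?_, fun n => ⟨0, |b| ^ n, fun x => ?_⟩⟩
  · exact (contDiff_const.mul Complex.ofRealCLM.contDiff).cexp
  · rw [norm_iteratedFDeriv_eq_norm_iteratedDeriv, hi]
    have : Complex.I * b * x = ((b * x : ℝ) : ℂ) * Complex.I := by push_cast; ring
    rw [norm_mul, this, Complex.norm_exp_ofReal_mul_I]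
    simp

/-- The first order equation `v' = A v - f` is solvable in the Schwartz space. -/
lemma solve_first (A : ℝ → ℝ) (hA : A.HasTemperateGrowth) (κ : ℝ) (hκ : 0 ≤ κ)
    (hpos : ∀ x, 1 ≤ A x + κ * (1 / (1 + x ^ 2))) (f : 𝓢(ℝ, ℂ)) :
    ∃ v : 𝓢(ℝ, ℂ), ∀ x, deriv v x = A x • v x - f x := by
  have hAc : Continuous A := hA.1.continuous
  set φ : ℝ → ℝ := fun x => ∫ t in (0 : ℝ)..x, A t with hφ
  have hφd : ∀ x, HasDerivAt φ (A x) x := fun x =>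
    intervalIntegral.integral_hasDerivAt_right (hAc.intervalIntegrable _ _)
      (hAc.stronglyMeasurableAtFilter _ _) hAc.continuousAt
  have hφc : Continuous φ := continuous_iff_continuousAt.2 fun x => (hφd x).continuousAt
  have hmono : Monotone (fun x => φ x + κ * Real.arctan x - x) := by
    have hd : ∀ x, HasDerivAt (fun x => φ x + κ * Real.arctan x - x)
        (A x + κ * (1 / (1 + x ^ 2)) - 1) x := fun x =>
      ((hφd x).add ((Real.hasDerivAt_arctan x).const_mul κ)).sub (hasDerivAt_id x)
    apply monotone_of_deriv_nonneg
    · exact fun x => (hd x).differentiableAt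
    · intro x
      rw [(hd x).deriv]
      linarith [hpos x]
  have hlow : ∀ x s, x ≤ s → φ x - φ s ≤ κ * Real.pi - (s - x) := by
    intro x s hxs
    have h1 := hmono hxs
    simp only at h1
    have h2 : Real.arctan s - Real.arctan x ≤ Real.pi := by
      linarith [Real.arctan_lt_pi_div_two s, Real.neg_pi_div_two_lt_arctan x]
    nlinarith
  set G : ℝ → ℂ := fun s => Real.exp (-φ s) • f s with hG
  have hGc : Continuous G := (Real.continuous_exp.comp hφc.neg).smul f.continuous
  have hGbd : ∀ x s, x ≤ s → ‖G s‖ ≤ Real.exp (-φ x) *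
      (Real.exp (κ * Real.pi) * (Real.exp (-(s - x)) * ‖f s‖)) := by
    intro x s hxs
    rw [hG]
    simp only [norm_smul, Real.norm_eq_abs, Real.abs_exp]
    rw [← mul_assoc, ← mul_assoc, ← Real.exp_add, ← Real.exp_add]
    gcongr
    linarith [hlow x s hxs]
  have hGi : ∀ x, IntegrableOn G (Set.Ioi x) := by
    intro x
    have hb : Integrable (fun s => Real.exp (-φ x) * Real.exp (κ * Real.pi) * ‖f s‖)
        (volume.restrict (Set.Ioi x)) :=
      (f.integrable.norm.const_mul _).integrableOn
    refine hb.mono' hGc.aestronglyMeasurable ?_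
    refine (ae_restrict_iff' measurableSet_Ioi).2 (Eventually.of_forall fun s hs => ?_)
    refine (hGbd x s (le_of_lt hs)).trans ?_
    rw [mul_assoc]
    have : Real.exp (-(s - x)) ≤ 1 := Real.exp_le_one_iff.2 (by linarith [Set.mem_Ioi.1 hs])
    have : Real.exp (-(s - x)) * ‖f s‖ ≤ ‖f s‖ :=
      mul_le_of_le_one_left (norm_nonneg _) this
    gcongr
  set v : ℝ → ℂ := fun x => Real.exp (φ x) • ∫ s in Set.Ioi x, G s with hv
  have hvd : ∀ x, HasDerivAt v (A x • v x - f x) x := by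
    intro x
    have hI : ∀ y, ∫ s in Set.Ioi y, G s = (∫ s in Set.Ioi 0, G s) - ∫ s in (0 : ℝ)..y, G s := by
      intro y
      rw [← intervalIntegral.integral_Ioi_sub_Ioi' (hGi 0) (hGi y)]; ring
    have h1 : HasDerivAt (fun y => ∫ s in Set.Ioi y, G s) (-G x) x := by
      have : (fun y => ∫ s in Set.Ioi y, G s) =
          fun y => (∫ s in Set.Ioi 0, G s) - ∫ s in (0 : ℝ)..y, G s := funext hI
      rw [this]
      exact (intervalIntegral.integral_hasDerivAt_right (hGc.intervalIntegrable _ _)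
        (hGc.stronglyMeasurableAtFilter _ _) hGc.continuousAt).const_sub _
    have h2 := (hφd x).exp.smul h1
    have e3 : A x • v x - f x =
        Real.exp (φ x) • -G x + (Real.exp (φ x) * A x) • ∫ s in Set.Ioi x, G s := by
      have e4 : Real.exp (φ x) • G x = f x := by
        simp only [hG, smul_smul]
        rw [← Real.exp_add]; simp
      rw [smul_neg, e4]
      simp only [hv, smul_smul]
      rw [mul_comm (A x)]
      abel
    rw [e3]
    exact h2
  have hvderiv : deriv v = fun x => A x • v x - f x := funext fun x => (hvd x).deriv
  have hvs : ContDiff ℝ ∞ v := by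
    rw [contDiff_infty]
    intro n
    induction n with
    | zero =>
      exact contDiff_zero.2 (continuous_iff_continuousAt.2 fun x => (hvd x).continuousAt)
    | succ n ih =>
      push_cast
      rw [contDiff_succ_iff_deriv]
      refine ⟨fun x => (hvd x).differentiableAt, by simp, ?_⟩
      rw [hvderiv]
      have h1 : ContDiff ℝ n A := contDiff_infty.1 hA.1 n
      have h2 : ContDiff ℝ n f := f.smooth n
      exact (h1.smul ih).sub h2
  have hdec0 : ∀ k : ℕ, ∃ C : ℝ, ∀ x, ‖x‖ ^ k * ‖v x‖ ≤ C := by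
    intro k
    have hint : Integrable (fun s => Real.exp (κ * Real.pi) *
        (2 ^ (k - 1) * (‖s‖ ^ k * ‖f s‖ + k.factorial * ‖f s‖))) :=
      (((f.integrable_pow_mul volume k).add
        (f.integrable.norm.const_mul _)).const_mul _).const_mul _
    refine ⟨∫ s, Real.exp (κ * Real.pi) *
        (2 ^ (k - 1) * (‖s‖ ^ k * ‖f s‖ + k.factorial * ‖f s‖)), fun x => ?_⟩
    have e1 : ‖x‖ ^ k * ‖v x‖ = ‖∫ s in Set.Ioi x, (‖x‖ ^ k * Real.exp (φ x)) • G s‖ := by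
      rw [integral_smul, hv]
      simp only [norm_smul, norm_mul, norm_pow, norm_norm]
      ring
    rw [e1]
    refine (norm_integral_le_integral_norm _).trans ?_
    refine le_trans ?_ (setIntegral_le_integral (s := Set.Ioi x) hint
      (Eventually.of_forall fun s => by positivity))
    refine setIntegral_mono_on (Integrable.norm (Integrable.smul (‖x‖ ^ k * Real.exp (φ x)) (hGi x))) hint.integrableOn measurableSet_Ioi ?_
    intro s hs
    have hs : x ≤ s := le_of_lt hs
    have hb := hGbd x s hs
    have hx : ‖x‖ ^ k * Real.exp (-(s - x)) ≤ 2 ^ (k - 1) * (‖s‖ ^ k + k.factorial) := by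
      have h1 : ‖x‖ ≤ ‖s‖ + (s - x) := by
        have := norm_sub_le s (s - x)
        rw [sub_sub_cancel] at this
        rwa [Real.norm_of_nonneg (by linarith : 0 ≤ s - x)] at this
      have h2 : ‖x‖ ^ k ≤ 2 ^ (k - 1) * (‖s‖ ^ k + (s - x) ^ k) :=
        (pow_le_pow_left₀ (norm_nonneg _) h1 k).trans
          (add_pow_le (norm_nonneg _) (by linarith) k)
      have h3 : (s - x) ^ k * Real.exp (-(s - x)) ≤ k.factorial := by
        have := Real.pow_div_factorial_le_exp (s - x) (by linarith) k
        rw [div_le_iff₀ (by positivity)] at this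
        rw [Real.exp_neg, ← div_eq_mul_inv, div_le_iff₀ (Real.exp_pos _)]
        linarith
      have h4 : Real.exp (-(s - x)) ≤ 1 := Real.exp_le_one_iff.2 (by linarith)
      calc ‖x‖ ^ k * Real.exp (-(s - x))
          ≤ 2 ^ (k - 1) * (‖s‖ ^ k + (s - x) ^ k) * Real.exp (-(s - x)) := by gcongr
        _ = 2 ^ (k - 1) * (‖s‖ ^ k * Real.exp (-(s - x)) +
            (s - x) ^ k * Real.exp (-(s - x))) := by ring
        _ ≤ 2 ^ (k - 1) * (‖s‖ ^ k * 1 + k.factorial) := by gcongr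
        _ = _ := by ring
    rw [norm_smul]
    simp only [norm_mul, norm_pow, Real.norm_eq_abs, Real.abs_exp, abs_abs] at *
    calc |x| ^ k * Real.exp (φ x) * ‖G s‖ ≤ |x| ^ k * Real.exp (φ x) * (Real.exp (-φ x) *
      (Real.exp (κ * Real.pi) * (Real.exp (-(s - x)) * ‖f s‖))) := by gcongr
      _ = (Real.exp (φ x) * Real.exp (-φ x)) * (Real.exp (κ * Real.pi) *
          ((|x| ^ k * Real.exp (-(s - x))) * ‖f s‖)) := by ring
      _ = Real.exp (κ * Real.pi) * ((|x| ^ k * Real.exp (-(s - x))) * ‖f s‖) := by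
          rw [← Real.exp_add]; simp
      _ ≤ Real.exp (κ * Real.pi) * ((2 ^ (k - 1) * (|s| ^ k + k.factorial)) * ‖f s‖) := by
          gcongr
      _ = _ := by ring
  have hdec : ∀ n : ℕ, ∀ k : ℕ, ∃ C : ℝ, ∀ x, ‖x‖ ^ k * ‖iteratedFDeriv ℝ n v x‖ ≤ C := by
    intro n
    induction n using Nat.strong_induction_on with
    | _ n ih =>
    rcases n with _ | n
    · simpa using hdec0
    intro k
    obtain ⟨l, B, hB0, hB⟩ := hA.norm_iteratedFDeriv_le_uniform n
    have ih1 : ∀ i : ℕ, ∃ C : ℝ, ∀ x,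
        ‖x‖ ^ k * ‖iteratedFDeriv ℝ (n - i) v x‖ ≤ C := fun i => ih (n - i) (by omega) k
    have ih2 : ∀ i : ℕ, ∃ C : ℝ, ∀ x,
        ‖x‖ ^ (k + l) * ‖iteratedFDeriv ℝ (n - i) v x‖ ≤ C := fun i => ih (n - i) (by omega) _
    choose C1 hC1 using ih1
    choose C2 hC2 using ih2
    obtain ⟨Cf, -, hCf⟩ := f.decay k n
    refine ⟨(∑ i ∈ Finset.range (n + 1), (n.choose i : ℝ) *
      (B * (2 ^ (l - 1) * (C1 i + C2 i)))) + Cf, fun x => ?_⟩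
    have e : ‖iteratedFDeriv ℝ (n + 1) v x‖ ≤
        ‖iteratedFDeriv ℝ n (fun y => A y • v y) x‖ + ‖iteratedFDeriv ℝ n f x‖ := by
      rw [norm_iteratedFDeriv_eq_norm_iteratedDeriv, iteratedDeriv_succ', hvderiv,
        ← norm_iteratedFDeriv_eq_norm_iteratedDeriv]
      have h1 : ContDiffAt ℝ n (fun y => A y • v y) x :=
        ((contDiff_infty.1 hA.1 n).smul (contDiff_infty.1 hvs n)).contDiffAt
      have h2 : ContDiffAt ℝ n f x := (f.smooth n).contDiffAt
      have := iteratedFDeriv_sub_apply (𝕜 := ℝ) h1 h2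
      have h3 : (fun x => A x • v x - f x) = (fun y => A y • v y) - ⇑f := rfl
      rw [h3, this]
      exact norm_sub_le _ _
    have e2 := norm_iteratedFDeriv_smul_le (𝕜 := ℝ) hA.1 hvs x (n := n)
      (by exact_mod_cast le_top)
    calc ‖x‖ ^ k * ‖iteratedFDeriv ℝ (n + 1) v x‖
        ≤ ‖x‖ ^ k * ((∑ i ∈ Finset.range (n + 1), (n.choose i : ℝ) * ‖iteratedFDeriv ℝ i A x‖
          * ‖iteratedFDeriv ℝ (n - i) v x‖) + ‖iteratedFDeriv ℝ n f x‖) := by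
          gcongr; linarith
      _ = (∑ i ∈ Finset.range (n + 1), (n.choose i : ℝ) * (‖iteratedFDeriv ℝ i A x‖
          * (‖x‖ ^ k * ‖iteratedFDeriv ℝ (n - i) v x‖))) +
            ‖x‖ ^ k * ‖iteratedFDeriv ℝ n f x‖ := by
          rw [mul_add, Finset.mul_sum]
          congr 1
          exact Finset.sum_congr rfl fun i _ => by ring
      _ ≤ _ := by
          refine add_le_add (Finset.sum_le_sum fun i hi => ?_) (hCf x)
          have hi' : i ≤ n := by simpa [Nat.lt_succ_iff] using hi
          refine mul_le_mul_of_nonneg_left ?_ (by positivity)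
          have h1 := hB i hi' x
          have h2 : (1 + ‖x‖) ^ l ≤ 2 ^ (l - 1) * (1 + ‖x‖ ^ l) := by
            simpa using add_pow_le (zero_le_one (α := ℝ)) (norm_nonneg x) l
          calc ‖iteratedFDeriv ℝ i A x‖ * (‖x‖ ^ k * ‖iteratedFDeriv ℝ (n - i) v x‖)
              ≤ (B * (2 ^ (l - 1) * (1 + ‖x‖ ^ l))) *
                (‖x‖ ^ k * ‖iteratedFDeriv ℝ (n - i) v x‖) := by
                gcongr
                exact h1.trans (by gcongr)
            _ = B * (2 ^ (l - 1) * (‖x‖ ^ k * ‖iteratedFDeriv ℝ (n - i) v x‖ +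
                ‖x‖ ^ (k + l) * ‖iteratedFDeriv ℝ (n - i) v x‖)) := by ring
            _ ≤ _ := by
                have := hC1 i x
                have := hC2 i x
                gcongr
  exact ⟨⟨v, hvs, fun k n => hdec n k⟩, fun x => (hvd x).deriv⟩

/-- The adjoint equation `g' = -A g + w`. -/
lemma solve_adj (A : ℝ → ℝ) (hA : A.HasTemperateGrowth) (κ : ℝ) (hκ : 0 ≤ κ)
    (hpos : ∀ x, 1 ≤ A x + κ * (1 / (1 + x ^ 2))) (w : 𝓢(ℝ, ℂ)) :
    ∃ g : 𝓢(ℝ, ℂ), ∀ x, deriv g x = w x - A x • g x := by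
  let R := SchwartzMap.compCLMOfContinuousLinearEquiv (F := ℂ) ℝ (ContinuousLinearEquiv.neg ℝ (M := ℝ))
  have hR : ∀ (u : 𝓢(ℝ, ℂ)) x, R u x = u (-x) := fun u x => rfl
  have hA' : (fun x => A (-x)).HasTemperateGrowth :=
    hA.comp (ContinuousLinearEquiv.neg ℝ (M := ℝ)).hasTemperateGrowth
  obtain ⟨v, hv⟩ := solve_first (fun x => A (-x)) hA' κ hκ
    (fun x => by simpa using hpos (-x)) (R w)
  refine ⟨R v, fun x => ?_⟩
  have : ⇑(R v) = fun x => v (-x) := funext fun x => hR v x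
  rw [this, deriv_comp_neg, hv, hR]
  simp

lemma le_of_sq_le_sq_aux {x y : ℝ} (hy : 0 ≤ y) (h : x ^ 2 ≤ y ^ 2) : x ≤ y :=
  (le_abs_self x).trans (abs_le_of_sq_le_sq h hy)

/-- Schwartz functions as elements of `L²`. -/
noncomputable def l2 : 𝓢(ℝ, ℂ) →L[ℂ] Lp ℂ 2 (volume : Measure ℝ) :=
  SchwartzMap.toLpCLM ℂ ℂ 2 volume

lemma l2_apply (u : 𝓢(ℝ, ℂ)) : l2 u = u.toLp 2 := rfl

lemma eLpNorm_eq_l2 (u : 𝓢(ℝ, ℂ)) : eLpNorm (⇑u) 2 volume = ENNReal.ofReal ‖l2 u‖ := by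
  rw [l2_apply, SchwartzMap.norm_toLp, ENNReal.ofReal_toReal (u.eLpNorm_lt_top 2 volume).ne]

lemma l2_norm_le (F G : 𝓢(ℝ, ℂ)) (K : ℝ) (h : ∀ x, ‖F x‖ ≤ K * ‖G x‖) :
    ‖l2 F‖ ≤ K * ‖l2 G‖ := by
  apply Lp.norm_le_mul_norm_of_ae_le_mul
  rw [l2_apply, l2_apply]
  filter_upwards [F.coeFn_toLp 2 volume, G.coeFn_toLp 2 volume] with x h1 h2
  rw [h1, h2]; exact h x

lemma l2_pos {u : 𝓢(ℝ, ℂ)} (h : u ≠ 0) : 0 < ‖l2 u‖ := by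
  rw [norm_pos_iff]
  intro h0
  apply h
  apply SchwartzMap.injective_toLp 2 volume
  change l2 u = l2 0
  rw [h0, map_zero]

lemma l2_norm_sq (u : 𝓢(ℝ, ℂ)) : ‖l2 u‖ ^ 2 = ∫ x, ‖u x‖ ^ 2 := by
  have h := SchwartzMap.inner_toL2_toL2_eq u u volume
  rw [← l2_apply, inner_self_eq_norm_sq_to_K] at h
  simp only [inner_self_eq_norm_sq_to_K] at h
  have h2 : ∫ x, ((‖u x‖ : ℂ)) ^ 2 = ((∫ x, ‖u x‖ ^ 2 : ℝ) : ℂ) := by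
    rw [← integral_complex_ofReal]; simp
  have h3 : ((‖l2 u‖ : ℂ)) ^ 2 = ((∫ x, ‖u x‖ ^ 2 : ℝ) : ℂ) := by rw [← h2]; exact h
  exact_mod_cast h3

/-- differentiation on Schwartz space -/
noncomputable abbrev DD : 𝓢(ℝ, ℂ) →L[ℂ] 𝓢(ℝ, ℂ) := SchwartzMap.derivCLM ℂ ℂ

/-- multiplication by a real function -/
noncomputable abbrev mm (A : ℝ → ℝ) : 𝓢(ℝ, ℂ) →L[ℝ] 𝓢(ℝ, ℂ) := SchwartzMap.smulLeftCLM ℂ A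

lemma mm_apply {A : ℝ → ℝ} (hA : A.HasTemperateGrowth) (u : 𝓢(ℝ, ℂ)) (x : ℝ) :
    mm A u x = (A x : ℂ) * u x := by
  rw [SchwartzMap.smulLeftCLM_apply_apply hA, Complex.real_smul]

lemma inner_DD (u v : 𝓢(ℝ, ℂ)) :
    inner ℂ (l2 u) (l2 (DD v)) = - inner ℂ (l2 (DD u)) (l2 v) := by
  rw [l2_apply, l2_apply, l2_apply, l2_apply, SchwartzMap.inner_toL2_toL2_eq _ _ volume,
    SchwartzMap.inner_toL2_toL2_eq _ _ volume]
  have := SchwartzMap.integral_bilinear_deriv_right_eq_neg_left u v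
    ((ContinuousLinearMap.mul ℝ ℂ).comp (Complex.conjCLE : ℂ →L[ℝ] ℂ))
  simpa [mul_comm] using this

lemma inner_mm {A : ℝ → ℝ} (hA : A.HasTemperateGrowth) (u v : 𝓢(ℝ, ℂ)) :
    inner ℂ (l2 (mm A u)) (l2 v) = inner ℂ (l2 u) (l2 (mm A v)) := by
  rw [l2_apply, l2_apply, l2_apply, l2_apply, SchwartzMap.inner_toL2_toL2_eq _ _ volume,
    SchwartzMap.inner_toL2_toL2_eq _ _ volume]
  congr 1
  ext x
  rw [mm_apply hA, mm_apply hA]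
  simp
  ring

lemma DD_mm {A : ℝ → ℝ} (hA : A.HasTemperateGrowth) (u : 𝓢(ℝ, ℂ)) :
    DD (mm A u) = mm (deriv A) u + mm A (DD u) := by
  ext x
  have hA' := temperate_deriv A hA
  rw [add_apply, mm_apply hA', mm_apply hA]
  have e : ⇑(mm A u) = fun x => (A x : ℂ) * u x := funext fun x => mm_apply hA u x
  rw [SchwartzMap.derivCLM_apply, SchwartzMap.derivCLM_apply, e]
  have h1 : HasDerivAt A (deriv A x) x :=
    ((hA.1.differentiable (by simp)) x).hasDerivAt
  exact (h1.ofReal_comp.mul (u.hasDerivAt x)).deriv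

/-- Energy estimate for first order operators `σ d/dx + A`. -/
lemma energy {A : ℝ → ℝ} (hA : A.HasTemperateGrowth) (σ : ℝ) (hσ : |σ| = 1) (P : ℝ) (hP : 0 ≤ P)
    (v X : 𝓢(ℝ, ℂ)) (hX : X = mm A v + (σ : ℂ) • DD v)
    (hd : ‖l2 (mm (deriv A) v)‖ ≤ P * (‖l2 v‖ + ‖l2 (mm A v)‖)) :
    ‖l2 (DD v)‖ ≤ ‖l2 X‖ + (1 + P) * ‖l2 v‖ ∧
    ‖l2 (mm A v)‖ ≤ 2 * (‖l2 X‖ + (1 + P) * ‖l2 v‖) := by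
  have h1 : ‖l2 X‖ ^ 2 = ‖l2 (mm A v)‖ ^ 2 +
      2 * (σ * (inner ℂ (l2 (mm A v)) (l2 (DD v))).re) + ‖l2 (DD v)‖ ^ 2 := by
    rw [hX, map_add, map_smul, @norm_add_sq ℂ, inner_smul_right, norm_smul]
    simp only [RCLike.re_to_complex, Complex.re_ofReal_mul, Complex.norm_real, Real.norm_eq_abs, hσ,
      one_mul]
  have h2 : inner ℂ (l2 (mm A v)) (l2 (DD v)) + inner ℂ (l2 (DD v)) (l2 (mm A v)) =
      - inner ℂ (l2 (mm (deriv A) v)) (l2 v) := by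
    rw [inner_DD, DD_mm hA, map_add, inner_add_left, inner_mm hA (DD v)]
    ring
  have h3 : 2 * (inner ℂ (l2 (mm A v)) (l2 (DD v))).re =
      - (inner ℂ (l2 (mm (deriv A) v)) (l2 v)).re := by
    have := congrArg Complex.re h2
    rw [Complex.add_re, Complex.neg_re, ← inner_conj_symm (l2 (DD v)), Complex.conj_re] at this
    linarith
  have h4 : |(inner ℂ (l2 (mm (deriv A) v)) (l2 v)).re| ≤ ‖l2 (mm (deriv A) v)‖ * ‖l2 v‖ :=
    (Complex.abs_re_le_norm _).trans (norm_inner_le_norm _ _)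
  have h5 : - (‖l2 (mm (deriv A) v)‖ * ‖l2 v‖) ≤
      2 * (σ * (inner ℂ (l2 (mm A v)) (l2 (DD v))).re) := by
    have e : 2 * (σ * (inner ℂ (l2 (mm A v)) (l2 (DD v))).re) =
      - (σ * (inner ℂ (l2 (mm (deriv A) v)) (l2 v)).re) := by
      linear_combination σ * h3
    rw [e]
    have : |σ * (inner ℂ (l2 (mm (deriv A) v)) (l2 v)).re| ≤
        ‖l2 (mm (deriv A) v)‖ * ‖l2 v‖ := by rw [abs_mul, hσ, one_mul]; exact h4
    linarith [(abs_le.1 this).2]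
  have n0 := norm_nonneg (l2 v)
  have n1 := norm_nonneg (l2 X)
  have n2 := norm_nonneg (l2 (mm A v))
  have n3 := norm_nonneg (l2 (DD v))
  generalize ‖l2 v‖ = y at *
  generalize ‖l2 X‖ = X' at *
  generalize ‖l2 (mm A v)‖ = z at *
  generalize ‖l2 (DD v)‖ = d at *
  have h6 : ‖l2 (mm (deriv A) v)‖ * y ≤ P * (y + z) * y := by gcongr
  have h7 : d ^ 2 + z ^ 2 / 2 ≤ (X' + (1 + P) * y) ^ 2 := by
    have : 0 ≤ X' * ((1 + P) * y) := by positivity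
    have : 0 ≤ P ^ 2 * y ^ 2 := by positivity
    have : 0 ≤ P * y ^ 2 := by positivity
    nlinarith [sq_nonneg (z - P * y)]
  have h8 : 0 ≤ X' + (1 + P) * y := by positivity
  constructor
  · refine le_of_sq_le_sq_aux h8 ?_
    nlinarith
  · refine le_of_sq_le_sq_aux (by positivity) ?_
    nlinarith

/-- Upper bound for the resolvent norm. -/
lemma resolvent_upper {A : ℝ → ℝ} (κ : ℝ) (hκ : 0 ≤ κ)
    (hpos : ∀ x, 1 ≤ A x + κ * (1 / (1 + x ^ 2))) (u f : 𝓢(ℝ, ℂ))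
    (hf : ∀ x, deriv u x = A x • u x - f x) :
    ‖l2 u‖ ≤ Real.exp (κ * Real.pi) * ‖l2 f‖ := by
  set ρ : ℝ → ℝ := fun x => Real.exp (2 * κ * Real.arctan x) with hρ
  have hρd : ∀ x, HasDerivAt ρ (ρ x * (2 * κ * (1 / (1 + x ^ 2)))) x := fun x =>
    ((Real.hasDerivAt_arctan x).const_mul (2 * κ)).exp
  have hρc : Continuous ρ := continuous_iff_continuousAt.2 fun x => (hρd x).continuousAt
  have hρu : ∀ x, ρ x ≤ Real.exp (κ * Real.pi) := fun x => by
    apply Real.exp_le_exp.2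
    nlinarith [Real.arctan_lt_pi_div_two x]
  have hρl : ∀ x, Real.exp (-(κ * Real.pi)) ≤ ρ x := fun x => by
    apply Real.exp_le_exp.2
    nlinarith [Real.neg_pi_div_two_lt_arctan x]
  have hρ0 : ∀ x, 0 < ρ x := fun x => Real.exp_pos _
  have isq : ∀ w : 𝓢(ℝ, ℂ), Integrable (fun x => ‖w x‖ ^ 2) := fun w => by
    have := (SchwartzMap.pairing (innerSL ℝ (E := ℂ)) w w).integrable (μ := volume)
    refine this.congr (Eventually.of_forall fun x => ?_)
    simp only [SchwartzMap.pairing_apply_apply]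
    exact real_inner_self_eq_norm_sq (w x)
  have iin : Integrable (fun x => 2 * inner ℝ (u x) (deriv u x)) := by
    have := (SchwartzMap.pairing (innerSL ℝ (E := ℂ)) u (DD u)).integrable (μ := volume)
    exact this.const_mul 2
  have hFd : ∀ x, HasDerivAt (fun x => ρ x * ‖u x‖ ^ 2)
      (ρ x * (2 * κ * (1 / (1 + x ^ 2))) * ‖u x‖ ^ 2 +
        ρ x * (2 * inner ℝ (u x) (deriv u x))) x := fun x =>
    (hρd x).mul (u.hasDerivAt x).norm_sq
  have iF : Integrable (fun x => ρ x * ‖u x‖ ^ 2) :=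
    (isq u).bdd_mul (c := Real.exp (κ * Real.pi)) hρc.aestronglyMeasurable
      (Eventually.of_forall fun x => by rw [Real.norm_of_nonneg (hρ0 x).le]; exact hρu x)
  have iF' : Integrable (fun x => ρ x * (2 * κ * (1 / (1 + x ^ 2))) * ‖u x‖ ^ 2 +
        ρ x * (2 * inner ℝ (u x) (deriv u x))) := by
    refine Integrable.add ?_ ?_
    · refine (isq u).bdd_mul (c := Real.exp (κ * Real.pi) * (2 * κ * 1)) ?_
        (Eventually.of_forall fun x => ?_)
      · apply Continuous.aestronglyMeasurable
        refine hρc.mul (continuous_const.mul ?_)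
        exact continuous_const.div (by fun_prop) (fun x => by positivity)
      · have h1 : 1 / (1 + x ^ 2) ≤ 1 := by
          rw [div_le_one (by positivity)]; nlinarith [sq_nonneg x]
        have h0 := (hρ0 x).le
        rw [Real.norm_of_nonneg (by positivity)]
        have := hρu x
        gcongr
    · exact iin.bdd_mul (c := Real.exp (κ * Real.pi)) hρc.aestronglyMeasurable
        (Eventually.of_forall fun x => by rw [Real.norm_of_nonneg (hρ0 x).le]; exact hρu x)
  have h0 := integral_eq_zero_of_hasDerivAt_of_integrable hFd iF' iF
  have hle : ∫ x, (Real.exp (-(κ * Real.pi)) * ‖u x‖ ^ 2 - Real.exp (κ * Real.pi) * ‖f x‖ ^ 2) ≤ 0 := by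
    rw [← h0]
    refine integral_mono (((isq u).const_mul _).sub ((isq f).const_mul _)) iF' fun x => ?_
    simp only
    rw [hf x, inner_sub_right, real_inner_smul_right, real_inner_self_eq_norm_sq]
    have c1 : inner ℝ (u x) (f x) ≤ ‖u x‖ * ‖f x‖ := real_inner_le_norm _ _
    have c2 := hpos x
    have c3 := hρ0 x
    have c4 := hρl x
    have c5 := hρu x
    have k1 : ‖u x‖ ^ 2 - ‖f x‖ ^ 2 ≤ 2 * κ * (1 / (1 + x ^ 2)) * ‖u x‖ ^ 2 +
        2 * (A x * ‖u x‖ ^ 2 - inner ℝ (u x) (f x)) := by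
      have : ‖u x‖ ^ 2 ≤ (A x + κ * (1 / (1 + x ^ 2))) * ‖u x‖ ^ 2 :=
        le_mul_of_one_le_left (by positivity) c2
      nlinarith [sq_nonneg (‖u x‖ - ‖f x‖)]
    have k2 : Real.exp (-(κ * Real.pi)) * ‖u x‖ ^ 2 ≤ ρ x * ‖u x‖ ^ 2 := by gcongr
    have k3 : ρ x * ‖f x‖ ^ 2 ≤ Real.exp (κ * Real.pi) * ‖f x‖ ^ 2 := by gcongr
    have k4 := mul_le_mul_of_nonneg_left k1 c3.le
    linarith
  rw [integral_sub ((isq u).const_mul _) ((isq f).const_mul _), integral_const_mul,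
    integral_const_mul, ← l2_norm_sq, ← l2_norm_sq] at hle
  refine le_of_sq_le_sq_aux (by positivity) ?_
  have e : Real.exp (κ * Real.pi) * Real.exp (-(κ * Real.pi)) = 1 := by
    rw [← Real.exp_add]; simp
  have := mul_le_mul_of_nonneg_left hle (Real.exp_pos (κ * Real.pi)).le
  have e2 : Real.exp (κ * Real.pi) * (Real.exp (-(κ * Real.pi)) * ‖l2 u‖ ^ 2) = ‖l2 u‖ ^ 2 := by
    rw [← mul_assoc, e, one_mul]
  rw [mul_sub, e2] at this
  linarith

/-- The remainder `-v'' + q v - 2 c a v + c² v`. -/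
noncomputable def remv (a q : ℝ → ℝ) (c : ℝ) (v : 𝓢(ℝ, ℂ)) : 𝓢(ℝ, ℂ) :=
  - DD (DD v) + mm q v - ((2 * c : ℝ) : ℂ) • mm a v + ((c ^ 2 : ℝ) : ℂ) • v

/-- The shifted Airy operator. -/
noncomputable def airy (a : ℝ → ℝ) (c : ℝ) (v : 𝓢(ℝ, ℂ)) : 𝓢(ℝ, ℂ) :=
  - DD v + mm a v - (c : ℂ) • v

lemma airy_apply {a : ℝ → ℝ} (ha : a.HasTemperateGrowth) (c : ℝ) (v : 𝓢(ℝ, ℂ)) (x : ℝ) :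
    airy a c v x = -deriv (⇑v) x + (a x : ℂ) * v x - (c : ℂ) * v x := by
  simp only [airy, sub_apply, add_apply, neg_apply,
    smul_apply, mm_apply ha, SchwartzMap.derivCLM_apply, smul_eq_mul]

lemma shift_temperate {a : ℝ → ℝ} (ha : a.HasTemperateGrowth) (c : ℝ) :
    (fun x => a x - c).HasTemperateGrowth :=
  ha.sub (Function.HasTemperateGrowth.const c)

lemma mm_shift {a : ℝ → ℝ} (ha : a.HasTemperateGrowth) (c : ℝ) (v : 𝓢(ℝ, ℂ)) :
    mm (fun x => a x - c) v = mm a v - (c : ℂ) • v := by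
  ext x
  simp only [sub_apply, smul_apply, mm_apply ha, mm_apply (shift_temperate ha c), smul_eq_mul]
  push_cast; ring

lemma airy_eq {a : ℝ → ℝ} (ha : a.HasTemperateGrowth) (c : ℝ) (v : 𝓢(ℝ, ℂ)) :
    airy a c v = mm (fun x => a x - c) v - DD v := by
  rw [mm_shift ha, airy]; abel

lemma deriv_shift (a : ℝ → ℝ) (c : ℝ) : deriv (fun x => a x - c) = deriv a := by
  ext x; simp

/-- The power-iteration step: improves a quasi-maximiser. -/
lemma power_step {A : ℝ → ℝ} (hA : A.HasTemperateGrowth) (M : ℝ) (hM : 0 < M)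
    (w g v : 𝓢(ℝ, ℂ)) (hw : w ≠ 0)
    (hMw : M * ‖l2 (mm A w - DD w)‖ ≤ ‖l2 w‖)
    (hg : w = mm A g + DD g) (hv : g = mm A v - DD v) :
    v ≠ 0 ∧ M * ‖l2 w‖ ≤ ‖l2 g‖ ∧ M * ‖l2 g‖ ≤ ‖l2 v‖ := by
  have adj : ∀ u y : 𝓢(ℝ, ℂ), inner ℂ (l2 (mm A u + DD u)) (l2 y) =
      inner ℂ (l2 u) (l2 (mm A y - DD y)) := by
    intro u y
    rw [map_add, map_sub, inner_add_left, inner_sub_right, inner_mm hA, inner_DD]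
    ring
  have hw0 := l2_pos hw
  have h1 : ‖l2 w‖ ^ 2 ≤ ‖l2 g‖ * ‖l2 (mm A w - DD w)‖ := by
    have e := adj g w
    rw [← hg, inner_self_eq_norm_sq_to_K] at e
    have : ‖(((‖l2 w‖ : ℝ) : ℂ)) ^ 2‖ = ‖l2 w‖ ^ 2 := by simp
    rw [← this]
    refine le_trans (le_of_eq ?_) (norm_inner_le_norm (𝕜 := ℂ) _ _)
    exact congrArg norm e
  have h2 : ‖l2 g‖ ^ 2 ≤ ‖l2 w‖ * ‖l2 v‖ := by
    have e := adj g v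
    rw [← hg, ← hv, inner_self_eq_norm_sq_to_K] at e
    have : ‖(((‖l2 g‖ : ℝ) : ℂ)) ^ 2‖ = ‖l2 g‖ ^ 2 := by simp
    rw [← this]
    refine le_trans (le_of_eq ?_) (norm_inner_le_norm (𝕜 := ℂ) _ _)
    exact (congrArg norm e).symm
  have h3 : M * ‖l2 w‖ ≤ ‖l2 g‖ := by
    have : M * ‖l2 w‖ * ‖l2 w‖ ≤ ‖l2 g‖ * ‖l2 w‖ := by
      calc M * ‖l2 w‖ * ‖l2 w‖ = M * ‖l2 w‖ ^ 2 := by ring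
        _ ≤ M * (‖l2 g‖ * ‖l2 (mm A w - DD w)‖) := by gcongr
        _ = ‖l2 g‖ * (M * ‖l2 (mm A w - DD w)‖) := by ring
        _ ≤ _ := by gcongr
    exact le_of_mul_le_mul_right this hw0
  have hg0 : 0 < ‖l2 g‖ := lt_of_lt_of_le (by positivity) h3
  refine ⟨?_, h3, ?_⟩
  · rintro rfl
    simp only [map_zero, norm_zero, mul_zero] at h2
    nlinarith
  · have : M * ‖l2 g‖ * ‖l2 g‖ ≤ ‖l2 v‖ * ‖l2 g‖ := by
      calc M * ‖l2 g‖ * ‖l2 g‖ = M * ‖l2 g‖ ^ 2 := by ring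
        _ ≤ M * (‖l2 w‖ * ‖l2 v‖) := by gcongr
        _ = ‖l2 v‖ * (M * ‖l2 w‖) := by ring
        _ ≤ _ := by gcongr
    exact le_of_mul_le_mul_right this hg0

/-- Uniform bound on the remainder. -/
lemma rem_bound {a q : ℝ → ℝ} (ha : a.HasTemperateGrowth) (hq : q.HasTemperateGrowth)
    (ha0 : ∀ x, 0 ≤ a x) (hq0 : ∀ x, 0 ≤ q x)
    (C1 K1 cm α : ℝ) (hC1 : 0 < C1) (hK1 : 0 < K1) (hcm : 0 ≤ cm) (hα : 0 < α)
    (hda : ∀ x, |deriv a x| ≤ C1 * (1 + a x)) (hqa : ∀ x, q x ≤ K1 * (1 + a x)) :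
    ∃ B : ℝ, 0 < B ∧ ∀ c, 0 ≤ c → c ≤ cm → ∀ w g v : 𝓢(ℝ, ℂ),
      w = mm (fun x => a x - c) g + DD g → g = mm (fun x => a x - c) v - DD v →
      ‖l2 w‖ ≤ α * ‖l2 g‖ → ‖l2 g‖ ≤ α * ‖l2 v‖ →
      ‖l2 (remv a q c v)‖ ≤ B * ‖l2 v‖ := by
  set P : ℝ := C1 * (1 + cm) with hP
  set Q1 : ℝ := 2 * (α + (1 + P)) with hQ1
  set Q2 : ℝ := α * α + (1 + P) * α with hQ2
  set Q3 : ℝ := 2 * Q2 + P * (1 + Q1) + (1 + P) * Q1 with hQ3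
  set Q4 : ℝ := Q1 + cm with hQ4
  refine ⟨Q3 + Q2 + K1 * (1 + Q4) + 2 * cm * Q4 + cm ^ 2, by positivity, ?_⟩
  intro c hc0 hc w g v hw hg hwg hgv
  have hA := shift_temperate ha c
  set A : ℝ → ℝ := fun x => a x - c with hAdef
  have hdA : deriv A = deriv a := deriv_shift a c
  have ha' := temperate_deriv a ha
  have n0 := norm_nonneg (l2 v)
  have hdom : ∀ (r : ℝ → ℝ), r.HasTemperateGrowth → ∀ C : ℝ, 0 ≤ C →
      (∀ x, |r x| ≤ C * (1 + a x)) → ∀ u : 𝓢(ℝ, ℂ),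
      ‖l2 (mm r u)‖ ≤ C * (‖l2 u‖ + ‖l2 (mm a u)‖) := by
    intro r hr C hC hra u
    have h1 : ‖l2 (mm r u)‖ ≤ C * ‖l2 (u + mm a u)‖ := by
      apply l2_norm_le
      intro x
      rw [add_apply, mm_apply hr, mm_apply ha]
      have e : u x + (a x : ℂ) * u x = ((1 + a x : ℝ) : ℂ) * u x := by push_cast; ring
      rw [e, norm_mul, norm_mul, Complex.norm_real, Complex.norm_real, Real.norm_eq_abs,
        Real.norm_of_nonneg (by linarith [ha0 x]), ← mul_assoc]
      gcongr
      exact hra x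
    refine h1.trans ?_
    gcongr
    rw [map_add]
    exact norm_add_le _ _
  have hma : ∀ u : 𝓢(ℝ, ℂ), ‖l2 (mm a u)‖ ≤ ‖l2 (mm A u)‖ + c * ‖l2 u‖ := by
    intro u
    have e : mm a u = mm A u + (c : ℂ) • u := by rw [hAdef, mm_shift ha]; abel
    rw [e, map_add, map_smul]
    refine (norm_add_le _ _).trans ?_
    rw [norm_smul, Complex.norm_real, Real.norm_of_nonneg hc0]
  have hd : ∀ u : 𝓢(ℝ, ℂ), ‖l2 (mm (deriv A) u)‖ ≤ P * (‖l2 u‖ + ‖l2 (mm A u)‖) := by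
    intro u
    rw [hdA]
    refine (hdom (deriv a) ha' C1 hC1.le hda u).trans ?_
    have := hma u
    have n1 := norm_nonneg (l2 u)
    have n2 := norm_nonneg (l2 (mm A u))
    rw [hP, mul_assoc]
    refine mul_le_mul_of_nonneg_left ?_ hC1.le
    nlinarith
  have hP0 : 0 ≤ P := by positivity
  have E1 := energy hA (-1) (by simp) P hP0 v g
    (by rw [hg]; ext x; simp [sub_eq_add_neg]) (hd v)
  have E2 := energy hA 1 (by simp) P hP0 g w (by rw [hw]; simp) (hd g)
  have E3 := energy hA (-1) (by simp) P hP0 (mm A v) (mm A g - mm (deriv A) v)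
    (by
      rw [DD_mm hA, hg, map_sub]
      ext x; simp only [sub_apply, add_apply, smul_apply]; push_cast; simp; ring) (hd _)
  have hAv : ‖l2 (mm A v)‖ ≤ Q1 * ‖l2 v‖ := by
    refine E1.2.trans ?_
    rw [hQ1]; linarith
  have hg2 : ‖l2 w‖ + (1 + P) * ‖l2 g‖ ≤ Q2 * ‖l2 v‖ := by
    have : ‖l2 w‖ ≤ α * (α * ‖l2 v‖) := hwg.trans (by gcongr)
    have : (1 + P) * ‖l2 g‖ ≤ (1 + P) * (α * ‖l2 v‖) := by gcongr
    rw [hQ2]; linarith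
  have hDg : ‖l2 (DD g)‖ ≤ Q2 * ‖l2 v‖ := E2.1.trans hg2
  have hAg : ‖l2 (mm A g)‖ ≤ 2 * (Q2 * ‖l2 v‖) := E2.2.trans (by linarith)
  have hDA : ‖l2 (DD (mm A v))‖ ≤ Q3 * ‖l2 v‖ := by
    refine E3.1.trans ?_
    have h1 : ‖l2 (mm A g - mm (deriv A) v)‖ ≤ ‖l2 (mm A g)‖ + ‖l2 (mm (deriv A) v)‖ := by
      rw [map_sub]; exact norm_sub_le _ _
    have h2 := hd v
    have h3 : P * (‖l2 v‖ + ‖l2 (mm A v)‖) ≤ P * (‖l2 v‖ + Q1 * ‖l2 v‖) := by gcongr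
    have h4 : (1 + P) * ‖l2 (mm A v)‖ ≤ (1 + P) * (Q1 * ‖l2 v‖) := by gcongr
    rw [hQ3]; linarith
  have hDD : ‖l2 (DD (DD v))‖ ≤ (Q3 + Q2) * ‖l2 v‖ := by
    have e : DD (DD v) = DD (mm A v) - DD g := by
      rw [hg, map_sub]; abel
    rw [e, map_sub]
    refine (norm_sub_le _ _).trans ?_
    linarith
  have hav : ‖l2 (mm a v)‖ ≤ Q4 * ‖l2 v‖ := by
    refine (hma v).trans ?_
    have : c * ‖l2 v‖ ≤ cm * ‖l2 v‖ := by gcongr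
    rw [hQ4]; linarith
  have hqv : ‖l2 (mm q v)‖ ≤ K1 * (1 + Q4) * ‖l2 v‖ := by
    refine (hdom q hq K1 hK1.le (fun x => by rw [abs_of_nonneg (hq0 x)]; exact hqa x) v).trans ?_
    have : K1 * (‖l2 v‖ + ‖l2 (mm a v)‖) ≤ K1 * (‖l2 v‖ + Q4 * ‖l2 v‖) := by gcongr
    linarith
  have h5 : ‖l2 (((2 * c : ℝ) : ℂ) • mm a v)‖ ≤ 2 * cm * Q4 * ‖l2 v‖ := by
    rw [map_smul, norm_smul, Complex.norm_real, Real.norm_of_nonneg (by positivity)]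
    calc 2 * c * ‖l2 (mm a v)‖ ≤ 2 * cm * (Q4 * ‖l2 v‖) := by gcongr
      _ = _ := by ring
  have h6 : ‖l2 (((c ^ 2 : ℝ) : ℂ) • v)‖ ≤ cm ^ 2 * ‖l2 v‖ := by
    rw [map_smul, norm_smul, Complex.norm_real, Real.norm_of_nonneg (by positivity)]
    gcongr
  have h7 : ‖l2 (remv a q c v)‖ ≤ ‖l2 (DD (DD v))‖ + ‖l2 (mm q v)‖ +
      ‖l2 (((2 * c : ℝ) : ℂ) • mm a v)‖ + ‖l2 (((c ^ 2 : ℝ) : ℂ) • v)‖ := by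
    rw [remv, map_add, map_sub, map_add, map_neg]
    refine (norm_add_le _ _).trans ?_
    gcongr
    refine (norm_sub_le _ _).trans ?_
    gcongr
    refine (norm_add_le _ _).trans ?_
    rw [norm_neg]
  linarith

/-- Conjugation by the oscillating factor. -/
lemma Tq_conj {a q : ℝ → ℝ} (ha : a.HasTemperateGrowth) (hq : q.HasTemperateGrowth)
    (c b : ℝ) (v : 𝓢(ℝ, ℂ)) :
    ∃ u : 𝓢(ℝ, ℂ), ‖l2 u‖ = ‖l2 v‖ ∧
      eLpNorm (Tq a q (-(c : ℂ) + Complex.I * (b : ℂ)) ⇑u) 2 volume =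
        ENNReal.ofReal ‖l2 ((2 * Complex.I * (b : ℂ)) • airy a c v + remv a q c v)‖ := by
  have hE := temperate_exp b
  set e : ℝ → ℂ := fun x => Complex.exp (Complex.I * b * x) with he
  have hen : ∀ x, ‖e x‖ = 1 := by
    intro x
    have : Complex.I * b * x = ((b * x : ℝ) : ℂ) * Complex.I := by push_cast; ring
    rw [he]; simp only
    rw [this, Complex.norm_exp_ofReal_mul_I]
  have hed : ∀ x : ℝ, HasDerivAt e ((Complex.I * b) * e x) x := by
    intro x
    have := ((Complex.ofRealCLM.hasDerivAt (x := x)).const_mul (Complex.I * b)).cexp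
    simp only [Complex.ofRealCLM_apply, Complex.ofReal_one, mul_one] at this
    rw [mul_comm (Complex.I * (b : ℂ)) (e x)]
    exact this
  set u : 𝓢(ℝ, ℂ) := SchwartzMap.smulLeftCLM ℂ e v with hu
  have hua : ∀ x, u x = e x * v x := fun x => by
    rw [hu, SchwartzMap.smulLeftCLM_apply_apply hE, smul_eq_mul]
  have huf : ⇑u = fun x => e x * v x := funext hua
  refine ⟨u, ?_, ?_⟩
  · apply le_antisymm
    · simpa using l2_norm_le u v 1 (fun x => by rw [hua, norm_mul, hen])
    · simpa using l2_norm_le v u 1 (fun x => by rw [hua, norm_mul, hen]; simp)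
  · rw [← eLpNorm_eq_l2]
    apply eLpNorm_congr_norm_ae
    refine Eventually.of_forall fun x => ?_
    have d1 : deriv ⇑u = fun x => Complex.I * b * e x * v x + e x * deriv (⇑v) x := by
      rw [huf]
      ext y
      exact ((hed y).mul (v.hasDerivAt y)).deriv
    have d2 : deriv (deriv ⇑u) x = Complex.I * b * (Complex.I * b * e x) * v x +
        Complex.I * b * e x * deriv (⇑v) x +
        (Complex.I * b * e x * deriv (⇑v) x + e x * deriv (deriv (⇑v)) x) := by
      rw [d1]
      have hv' : HasDerivAt (deriv ⇑v) (deriv (deriv ⇑v) x) x := (DD v).hasDerivAt x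
      exact ((((hed x).const_mul (Complex.I * b)).mul (v.hasDerivAt x)).add
        ((hed x).mul hv')).deriv
    have d3 : DD (DD v) x = deriv (deriv ⇑v) x := rfl
    have key : Tq a q (-(c : ℂ) + Complex.I * (b : ℂ)) (⇑u) x =
        e x * ((2 * Complex.I * (b : ℂ)) • airy a c v + remv a q c v : 𝓢(ℝ, ℂ)) x := by
      simp only [Tq, d2, hua, add_apply, smul_apply, airy_apply ha, remv, sub_apply, neg_apply,
        mm_apply ha, mm_apply hq, d3, smul_eq_mul]
      push_cast
      ring
    rw [key, norm_mul, hen, one_mul]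


lemma lt_NA_iff {a : ℝ → ℝ} (ha : a.HasTemperateGrowth) (c M : ℝ) (hM : 0 ≤ M) :
    ENNReal.ofReal M < NA a c ↔
      ∃ w : 𝓢(ℝ, ℂ), w ≠ 0 ∧ M * ‖l2 (airy a c w)‖ < ‖l2 w‖ := by
  have key : ∀ w : 𝓢(ℝ, ℂ), w ≠ 0 → (ENNReal.ofReal M < eLpNorm (⇑w) 2 volume /
      eLpNorm (fun x => -deriv (⇑w) x + (a x : ℂ) * w x - (c : ℂ) * w x) 2 volume ↔
      M * ‖l2 (airy a c w)‖ < ‖l2 w‖) := by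
    intro w hw
    have e : (fun x => -deriv (⇑w) x + (a x : ℂ) * w x - (c : ℂ) * w x) = ⇑(airy a c w) := by
      funext x; rw [airy_apply ha]
    rw [e, eLpNorm_eq_l2, eLpNorm_eq_l2,
      ENNReal.lt_div_iff_mul_lt (Or.inr ENNReal.ofReal_ne_top) (Or.inl ENNReal.ofReal_ne_top),
      ← ENNReal.ofReal_mul hM, ENNReal.ofReal_lt_ofReal_iff (l2_pos hw)]
  rw [NA]
  simp only [lt_iSup_iff]
  constructor
  · rintro ⟨w, hw, h⟩
    exact ⟨w, hw, (key w hw).1 h⟩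
  · rintro ⟨w, hw, h⟩
    exact ⟨w, hw, (key w hw).2 h⟩

/-- Lower bound for the shifted damping, uniform for `c ≤ cm`. -/
lemma exists_kappa {a : ℝ → ℝ} (ha0 : ∀ x, 0 ≤ a x) (hlim : Tendsto a (cocompact ℝ) atTop)
    (cm : ℝ) (hcm : 0 ≤ cm) : ∃ κ : ℝ, 0 ≤ κ ∧ ∀ c, c ≤ cm → ∀ x,
      1 ≤ (a x - c) + κ * (1 / (1 + x ^ 2)) := by
  have h1 : ∀ᶠ x in cocompact ℝ, cm + 1 ≤ a x := hlim.eventually_ge_atTop _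
  obtain ⟨r, hr⟩ := (Filter.hasBasis_cocompact.eventually_iff.1 h1)
  obtain ⟨R, hR⟩ := hr.1.isBounded.subset_closedBall 0
  refine ⟨(cm + 1) * (1 + R ^ 2), by positivity, ?_⟩
  intro c hc x
  by_cases hx : x ∈ r
  · have h2 : |x| ≤ R := by simpa using hR hx
    have h3 : x ^ 2 ≤ R ^ 2 := by
      rw [← sq_abs x]; gcongr
    have h4 : cm + 1 ≤ (cm + 1) * (1 + R ^ 2) * (1 / (1 + x ^ 2)) := by
      rw [mul_one_div, le_div_iff₀ (by positivity)]
      gcongr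
    linarith [ha0 x]
  · have h2 := hr.2 hx
    have h4 : 0 ≤ (cm + 1) * (1 + R ^ 2) * (1 / (1 + x ^ 2)) := by positivity
    linarith

lemma exists_K1 {a q : ℝ → ℝ} (h : Standing a q) :
    ∃ K1 : ℝ, 0 < K1 ∧ ∀ x, q x ≤ K1 * (1 + a x) := by
  obtain ⟨K0, hK0, x0, hx0, hq⟩ := h.q_le_a
  obtain ⟨S, hS⟩ := (isCompact_Icc (a := -x0) (b := x0)).bddAbove_image
    (h.smooth_q.continuous.continuousOn)
  refine ⟨K0 + |S|, by positivity, fun x => ?_⟩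
  have ha := h.nonneg_a x
  have hS0 := abs_nonneg S
  by_cases hx : x0 < |x|
  · have := hq x hx
    nlinarith [mul_nonneg hS0 ha]
  · have h1 : q x ≤ S := hS ⟨x, abs_le.1 (not_lt.1 hx), rfl⟩
    have := le_abs_self S
    nlinarith [mul_nonneg hS0 ha, mul_nonneg hK0.le ha]

theorem stmt8 (a q : ℝ → ℝ) (h : Standing a q)
    (K : Set ℝ) (hKb : Bornology.IsBounded K) (hK : K ⊆ Set.Ici 0) :
    ∃ C : ℝ, 0 < C ∧ ∃ b₀ : ℝ, 0 < b₀ ∧ ∀ c ∈ K, ∀ b : ℝ, b₀ ≤ b →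
      ∀ M : ℝ, ENNReal.ofReal M < NA a c →
        ∃ u : SchwartzMap ℝ ℂ, u ≠ 0 ∧
          ENNReal.ofReal M * eLpNorm (Tq a q (-(c : ℂ) + Complex.I * (b : ℂ)) ⇑u) 2 volume
            ≤ ENNReal.ofReal (2 * b + C) * eLpNorm (⇑u) 2 volume := by
  have ha := symbol_temperate a h.smooth_a h.nonneg_a h.deriv_a
  have hq := symbol_temperate q h.smooth_q h.nonneg_q h.deriv_q
  obtain ⟨C1, hC1, hda⟩ := symbol_deriv_bound a h.nonneg_a h.deriv_a
  obtain ⟨K1, hK1, hqa⟩ := exists_K1 h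
  obtain ⟨cm, hcm, hcK⟩ : ∃ cm : ℝ, 0 ≤ cm ∧ ∀ c ∈ K, c ≤ cm := by
    obtain ⟨R, hR⟩ := hKb.subset_closedBall 0
    refine ⟨|R|, abs_nonneg R, fun c hc => ?_⟩
    have : |c| ≤ R := by simpa using hR hc
    exact (le_abs_self c).trans (this.trans (le_abs_self R))
  obtain ⟨κ, hκ, hpos⟩ := exists_kappa h.nonneg_a h.unbounded_a cm hcm
  by_cases hne : ∃ u0 : 𝓢(ℝ, ℂ), u0 ≠ 0
  swap
  · push Not at hne
    refine ⟨1, one_pos, 1, one_pos, fun c hc b hb M hM => ?_⟩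
    exfalso
    have h0 : ENNReal.ofReal 0 < NA a c := by
      rw [ENNReal.ofReal_zero]; exact lt_of_le_of_lt zero_le hM
    obtain ⟨w, hw, -⟩ := (lt_NA_iff ha c 0 le_rfl).1 h0
    exact hw (hne w)
  obtain ⟨u0, hu0⟩ := hne
  have hu0p := l2_pos hu0
  set dn : ℝ := ‖l2 (mm a u0 - DD u0)‖ + cm * ‖l2 u0‖ + 1 with hdn
  have hdn0 : 0 < dn := by positivity
  set m0 : ℝ := ‖l2 u0‖ / dn with hm0
  have hm0p : 0 < m0 := by positivity
  have hm0lt : ∀ c ∈ K, ENNReal.ofReal m0 < NA a c := by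
    intro c hc
    rw [lt_NA_iff ha c m0 hm0p.le]
    refine ⟨u0, hu0, ?_⟩
    have e : airy a c u0 = (mm a u0 - DD u0) - (c : ℂ) • u0 := by
      rw [airy]; abel
    have h1 : ‖l2 (airy a c u0)‖ < dn := by
      rw [e, map_sub, map_smul]
      refine lt_of_le_of_lt (norm_sub_le _ _) ?_
      rw [norm_smul, Complex.norm_real, Real.norm_of_nonneg (hK hc), hdn]
      have := mul_le_mul_of_nonneg_right (hcK c hc) hu0p.le
      linarith
    calc m0 * ‖l2 (airy a c u0)‖ < m0 * dn := by gcongr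
      _ = ‖l2 u0‖ := by rw [hm0]; field_simp
  obtain ⟨B, hB, hrem⟩ := rem_bound ha hq h.nonneg_a h.nonneg_q C1 K1 cm (1 / m0) hC1 hK1 hcm
    (by positivity) hda hqa
  set N : ℝ := Real.exp (κ * Real.pi) with hN
  have hN0 : 0 < N := Real.exp_pos _
  refine ⟨N * B, by positivity, 1, one_pos, fun c hc b hb M hM => ?_⟩
  have hc0 : 0 ≤ c := hK hc
  have hposc := hpos c (hcK c hc)
  have hA := shift_temperate ha c
  set M' : ℝ := max M m0 with hM'
  have hM'0 : 0 < M' := lt_of_lt_of_le hm0p (le_max_right _ _)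
  have hM'lt : ENNReal.ofReal M' < NA a c := by
    rcases max_choice M m0 with e | e
    · rw [hM', e]; exact hM
    · rw [hM', e]; exact hm0lt c hc
  obtain ⟨w, hw, hMw⟩ := (lt_NA_iff ha c M' hM'0.le).1 hM'lt
  have hwp := l2_pos hw
  have hup := resolvent_upper (A := fun x => a x - c) κ hκ hposc w (airy a c w) (by
    intro x
    rw [airy_apply ha, Complex.real_smul]
    push_cast; ring)
  have hM'N : M' ≤ N := by
    by_contra hcon
    push Not at hcon
    have : N * ‖l2 (airy a c w)‖ ≤ M' * ‖l2 (airy a c w)‖ := by gcongr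
    linarith
  obtain ⟨g, hg⟩ := solve_adj (fun x => a x - c) hA κ hκ hposc w
  obtain ⟨v, hv⟩ := solve_first (fun x => a x - c) hA κ hκ hposc g
  have hg' : w = mm (fun x => a x - c) g + DD g := by
    ext x
    rw [add_apply, mm_apply hA, SchwartzMap.derivCLM_apply, hg x, Complex.real_smul]
    ring
  have hv' : g = mm (fun x => a x - c) v - DD v := by
    ext x
    rw [sub_apply, mm_apply hA, SchwartzMap.derivCLM_apply, hv x, Complex.real_smul]
    ring
  obtain ⟨hv0, hwg, hgv⟩ := power_step hA M' hM'0 w g v hw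
    (by rw [← airy_eq ha]; exact hMw.le) hg' hv'
  have hinv : ∀ s t : ℝ, 0 ≤ s → M' * s ≤ t → s ≤ 1 / m0 * t := by
    intro s t hs hst
    rw [one_div_mul_eq_div, le_div_iff₀ hm0p]
    have : m0 * s ≤ M' * s := mul_le_mul_of_nonneg_right (le_max_right _ _) hs
    linarith
  have hR := hrem c hc0 (hcK c hc) w g v hg' hv' (hinv _ _ (norm_nonneg _) hwg)
    (hinv _ _ (norm_nonneg _) hgv)
  obtain ⟨u, hu, hTu⟩ := Tq_conj ha hq c b v
  have hvp := l2_pos hv0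
  refine ⟨u, ?_, ?_⟩
  · rintro rfl
    rw [map_zero, norm_zero] at hu
    linarith
  have hb0 : 0 < b := lt_of_lt_of_le one_pos hb
  rw [hTu, eLpNorm_eq_l2, hu, airy_eq ha, ← hv']
  refine le_trans (mul_le_mul_left (ENNReal.ofReal_le_ofReal (le_max_left M m0)) _) ?_
  rw [← hM', ← ENNReal.ofReal_mul hM'0.le, ← ENNReal.ofReal_mul (by positivity)]
  apply ENNReal.ofReal_le_ofReal
  have h1 : ‖l2 ((2 * Complex.I * (b : ℂ)) • g + remv a q c v)‖ ≤
      2 * b * ‖l2 g‖ + ‖l2 (remv a q c v)‖ := by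
    rw [map_add, map_smul]
    refine (norm_add_le _ _).trans ?_
    rw [norm_smul]
    have : ‖2 * Complex.I * (b : ℂ)‖ = 2 * b := by
      simp [abs_of_pos hb0]
    rw [this]
  calc M' * ‖l2 ((2 * Complex.I * (b : ℂ)) • g + remv a q c v)‖
      ≤ M' * (2 * b * ‖l2 g‖ + ‖l2 (remv a q c v)‖) := by gcongr
    _ = 2 * b * (M' * ‖l2 g‖) + M' * ‖l2 (remv a q c v)‖ := by ring
    _ ≤ 2 * b * ‖l2 v‖ + N * (B * ‖l2 v‖) := by gcongr
    _ = _ := by ring
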